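/- arXiv:2408.03668 — 4 statements merged into one kernel-verified Lean document; each statement's English description precedes it below -/
import Mathlib

section
/- Suppose char(F_q) ≠ 3. There is an absolute constant C > 0, independent of q, such that for every monic irreducible ϖ ∈ F_q[t] and every integer e ≥ 1, Σ_{k ∈ O, |k| < |ϖ|^e} 1/ρ̃(ϖ^e,k) ≤ |ϖ|^e · (1 + C·|ϖ|^{−3/2}), where the sum is over all polynomials k of degree less than e·deg ϖ (including k = 0). -/
open Polynomial

/-- The normalised local density
`ρ̃(N,k) = |N|^{−2}·#{(x,y,z) ∈ (O/NO)³ : x³ + y³ + z³ ≡ k (mod N)}`. -/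
noncomputable def rhoTilde (Fq : Type) [Field Fq] [Fintype Fq] (N k : Polynomial Fq) : ℝ :=
  (Nat.card {v : (Polynomial Fq ⧸ Ideal.span {N}) × (Polynomial Fq ⧸ Ideal.span {N}) ×
      (Polynomial Fq ⧸ Ideal.span {N}) //
      v.1 ^ 3 + v.2.1 ^ 3 + v.2.2 ^ 3 = Ideal.Quotient.mk (Ideal.span {N}) k} : ℝ) /
    ((Fintype.card Fq : ℝ) ^ N.natDegree) ^ 2

set_option linter.unusedSectionVars false

section Fourier
variable {F : Type} [Field F] [Fintype F] [DecidableEq F]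

lemma aux_parseval (ψ : AddChar F ℂ) (hψ : ψ.IsPrimitive) (c : F → ℂ) :
    ∑ a, ‖∑ b, c b * ψ (a * b)‖ ^ 2 = (Fintype.card F : ℝ) * ∑ b, ‖c b‖ ^ 2 := by
  have h : ((∑ a, ‖∑ b, c b * ψ (a * b)‖ ^ 2 : ℝ) : ℂ)
      = (((Fintype.card F : ℝ) * ∑ b, ‖c b‖ ^ 2 : ℝ) : ℂ) := by
    push_cast
    have h1 : ∀ a, ((‖∑ b, c b * ψ (a * b)‖ : ℂ)) ^ 2
        = ∑ b, ∑ b', c b * (starRingEnd ℂ) (c b') * ψ (a * (b - b')) := by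
      intro a
      rw [← Complex.mul_conj', map_sum, Finset.sum_mul_sum]
      refine Finset.sum_congr rfl fun b _ => Finset.sum_congr rfl fun b' _ => ?_
      rw [map_mul (starRingEnd ℂ), ← AddChar.map_neg_eq_conj, mul_sub, sub_eq_add_neg, AddChar.map_add_eq_mul]
      ring
    simp_rw [h1]
    rw [Finset.sum_comm, Finset.mul_sum]
    refine Finset.sum_congr rfl fun b _ => ?_
    rw [Finset.sum_comm]
    simp_rw [← Finset.mul_sum, AddChar.sum_mulShift _ hψ, sub_eq_zero]
    simp [← Complex.mul_conj']
    ring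
  exact_mod_cast h

lemma aux_cube_fiber (y : F) : (Finset.univ.filter fun x : F => x ^ 3 = y).card ≤ 3 := by
  calc _ ≤ (nthRoots 3 y).toFinset.card := by
        apply Finset.card_le_card
        intro x hx
        simp at hx
        simp [mem_nthRoots, hx]
    _ ≤ (nthRoots 3 y).card := Multiset.toFinset_card_le _
    _ ≤ 3 := card_nthRoots _ _

noncomputable def auxS (ψ : AddChar F ℂ) (b : F) : ℂ := ∑ x : F, ψ (b * x ^ 3)

lemma auxS_sq_sum (ψ : AddChar F ℂ) (hψ : ψ.IsPrimitive) :
    ∑ b, ‖auxS ψ b‖ ^ 2 ≤ 3 * (Fintype.card F : ℝ) ^ 2 := by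
  have h1 : ∀ b, auxS ψ b
      = ∑ y, ((Finset.univ.filter fun x : F => x ^ 3 = y).card : ℂ) * ψ (b * y) := by
    intro b
    unfold auxS
    rw [← Finset.sum_fiberwise (s := Finset.univ) (g := fun x : F => x ^ 3)]
    refine Finset.sum_congr rfl fun y _ => ?_
    rw [← nsmul_eq_mul, ← Finset.sum_const]
    refine Finset.sum_congr rfl fun x hx => ?_
    simp at hx
    rw [hx]
  simp_rw [h1]
  rw [aux_parseval ψ hψ]
  have h2 : ∑ y : F, ((Finset.univ.filter fun x : F => x ^ 3 = y).card : ℝ)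
      = Fintype.card F := by
    have := Finset.card_eq_sum_card_fiberwise (s := (Finset.univ : Finset F))
      (t := Finset.univ) (f := fun x : F => x ^ 3) (by simp)
    rw [Finset.card_univ] at this
    rw [this]
    push_cast
    rfl
  have h3 : ∑ y : F, ‖((Finset.univ.filter fun x : F => x ^ 3 = y).card : ℂ)‖ ^ 2
      ≤ 3 * (Fintype.card F : ℝ) := by
    rw [← h2, Finset.mul_sum]
    refine Finset.sum_le_sum fun y _ => ?_
    rw [Complex.norm_natCast, sq]
    have := aux_cube_fiber y
    gcongr
    exact_mod_cast this
  nlinarith [(Nat.cast_nonneg (Fintype.card F) : (0:ℝ) ≤ _)]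

lemma auxS_sq_le (ψ : AddChar F ℂ) (hψ : ψ.IsPrimitive) (b : F) (hb : b ≠ 0) :
    ‖auxS ψ b‖ ^ 2 ≤ 18 * (Fintype.card F : ℝ) := by
  have hinv : ∀ c : F, c ≠ 0 → auxS ψ (b * c ^ 3) = auxS ψ b := by
    intro c hc
    unfold auxS
    refine Fintype.sum_equiv (Equiv.mulLeft₀ c hc) _ _ fun x => ?_
    simp only [Equiv.mulLeft₀_apply]
    congr 1; ring
  have h1 : ∑ c ∈ Finset.univ.filter (fun c : F => c ≠ 0), ‖auxS ψ (b * c ^ 3)‖ ^ 2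
      = ((Fintype.card F : ℝ) - 1) * ‖auxS ψ b‖ ^ 2 := by
    rw [Finset.sum_congr rfl (g := fun _ => ‖auxS ψ b‖ ^ 2)]
    · rw [Finset.sum_const, Finset.filter_ne', Finset.card_erase_of_mem (Finset.mem_univ _),
        Finset.card_univ, nsmul_eq_mul, Nat.cast_sub Fintype.card_pos]
      simp
    · intro c hc
      simp at hc
      rw [hinv c hc]
  have h2 : ∑ c : F, ‖auxS ψ (b * c ^ 3)‖ ^ 2 ≤ 3 * ∑ b', ‖auxS ψ b'‖ ^ 2 := by
    rw [← Finset.sum_fiberwise (s := Finset.univ) (g := fun x : F => b * x ^ 3), Finset.mul_sum]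
    refine Finset.sum_le_sum fun y _ => ?_
    rw [Finset.sum_congr rfl (g := fun _ => ‖auxS ψ y‖ ^ 2)]
    · rw [Finset.sum_const, nsmul_eq_mul]
      gcongr
      have := aux_cube_fiber (b⁻¹ * y)
      refine le_trans (Nat.cast_le.2 (Finset.card_le_card ?_)) (Nat.cast_le.2 this) |>.trans (by norm_num)
      intro x hx
      simp at hx ⊢
      rw [← hx]; field_simp
    · intro c hc
      simp at hc
      rw [hc]
  have h3 : ∑ c ∈ Finset.univ.filter (fun c : F => c ≠ 0), ‖auxS ψ (b * c ^ 3)‖ ^ 2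
      ≤ ∑ c : F, ‖auxS ψ (b * c ^ 3)‖ ^ 2 :=
    Finset.sum_le_sum_of_subset_of_nonneg (Finset.filter_subset _ _) (fun _ _ _ => by positivity)
  have h4 := auxS_sq_sum ψ hψ
  have h5 : (2 : ℝ) ≤ Fintype.card F := by
    exact_mod_cast Fintype.one_lt_card (α := F)
  set Q : ℝ := ((Fintype.card F : ℕ) : ℝ)
  set s := ‖auxS ψ b‖ ^ 2
  have hs : 0 ≤ s := by positivity
  have h6 : (Q - 1) * s ≤ 9 * Q ^ 2 := by linarith
  have h7 : Q / 2 * s ≤ (Q - 1) * s := by gcongr; linarith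
  have h8 : Q * s ≤ Q * (18 * Q) := by nlinarith
  exact le_of_mul_le_mul_left h8 (by linarith)

def auxN (a : F) : ℕ :=
  (Finset.univ.filter fun v : F × F × F => v.1 ^ 3 + v.2.1 ^ 3 + v.2.2 ^ 3 = a).card

lemma auxN_fourier (ψ : AddChar F ℂ) (hψ : ψ.IsPrimitive) (a : F) :
    (Fintype.card F : ℂ) * ((auxN a : ℂ) - (Fintype.card F : ℂ) ^ 2)
      = ∑ b, (if b = 0 then 0 else auxS ψ b ^ 3) * ψ ((-a) * b) := by
  have h1 : (Fintype.card F : ℂ) * (auxN a : ℂ) = ∑ b, auxS ψ b ^ 3 * ψ ((-a) * b) := by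
    have e1 : ∀ b, auxS ψ b ^ 3 * ψ ((-a) * b)
        = ∑ v : F × F × F, ψ (b * (v.1 ^ 3 + v.2.1 ^ 3 + v.2.2 ^ 3 - a)) := by
      intro b
      rw [Fintype.sum_prod_type]
      simp_rw [Fintype.sum_prod_type]
      unfold auxS
      rw [pow_succ, pow_two, mul_assoc, mul_assoc, Finset.sum_mul]
      refine Finset.sum_congr rfl fun x _ => ?_
      rw [Finset.sum_mul, Finset.mul_sum]
      refine Finset.sum_congr rfl fun y _ => ?_
      rw [Finset.sum_mul, Finset.mul_sum, Finset.mul_sum]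
      refine Finset.sum_congr rfl fun z _ => ?_
      rw [← AddChar.map_add_eq_mul, ← AddChar.map_add_eq_mul, ← AddChar.map_add_eq_mul]
      congr 1; ring
    simp_rw [e1]
    rw [Finset.sum_comm]
    simp_rw [AddChar.sum_mulShift _ hψ, sub_eq_zero]
    rw [auxN]
    push_cast
    rw [← Finset.sum_filter, Finset.sum_const, nsmul_eq_mul, mul_comm]
  have h2 : ∀ b, (if b = 0 then 0 else auxS ψ b ^ 3) * ψ ((-a) * b)
      = auxS ψ b ^ 3 * ψ ((-a) * b) - if b = 0 then (Fintype.card F : ℂ) ^ 3 else 0 := by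
    intro b
    split_ifs with hb
    · subst hb
      simp [auxS]
    · simp
  simp_rw [h2]
  rw [Finset.sum_sub_distrib, ← h1]
  simp
  ring

lemma auxN_var : ∑ a : F, ((auxN a : ℝ) - (Fintype.card F : ℝ) ^ 2) ^ 2
    ≤ 972 * (Fintype.card F : ℝ) ^ 3 := by
  obtain ⟨ψ, hψ⟩ : ∃ ψ : AddChar F ℂ, ψ.IsPrimitive :=
    ⟨_, AddChar.FiniteField.primitiveChar_to_Complex_isPrimitive F⟩
  set Q : ℝ := ((Fintype.card F : ℕ) : ℝ) with hQ
  have hQ0 : 0 < Q := by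
    have : 0 < Fintype.card F := Fintype.card_pos
    rw [hQ]; exact_mod_cast this
  have h1 : ∑ a : F, (Q * ((auxN a : ℝ) - Q ^ 2)) ^ 2
      = Q * ∑ b : F, ‖(if b = 0 then 0 else auxS ψ b ^ 3 : ℂ)‖ ^ 2 := by
    rw [← aux_parseval ψ hψ]
    refine Fintype.sum_equiv (Equiv.neg F) _ _ fun a => ?_
    simp only [Equiv.neg_apply]
    rw [← auxN_fourier ψ hψ a, ← sq_abs, ← Real.norm_eq_abs, ← Complex.norm_real]
    push_cast
    simp [hQ]
  have h2 : ∑ b : F, ‖(if b = 0 then 0 else auxS ψ b ^ 3 : ℂ)‖ ^ 2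
      ≤ ∑ b : F, (18 * Q) ^ 2 * ‖auxS ψ b‖ ^ 2 := by
    refine Finset.sum_le_sum fun b _ => ?_
    split_ifs with hb
    · simp; positivity
    · rw [norm_pow]
      have := auxS_sq_le ψ hψ b hb
      calc (‖auxS ψ b‖ ^ 3) ^ 2 = (‖auxS ψ b‖ ^ 2) ^ 2 * ‖auxS ψ b‖ ^ 2 := by ring
        _ ≤ _ := by gcongr
  rw [← Finset.mul_sum] at h2
  have h3 := auxS_sq_sum ψ hψ
  have h4 : ∑ a : F, (Q * ((auxN a : ℝ) - Q ^ 2)) ^ 2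
      = Q ^ 2 * ∑ a : F, ((auxN a : ℝ) - Q ^ 2) ^ 2 := by
    rw [Finset.mul_sum]
    exact Finset.sum_congr rfl fun a _ => by ring
  rw [h4] at h1
  have h5 : Q ^ 2 * ∑ a : F, ((auxN a : ℝ) - Q ^ 2) ^ 2 ≤ Q ^ 2 * (972 * Q ^ 3) := by
    rw [h1]
    calc _ ≤ Q * ((18 * Q) ^ 2 * (3 * Q ^ 2)) := by
          gcongr
          exact h2.trans (by gcongr)
      _ = _ := by ring
  exact le_of_mul_le_mul_left h5 (by positivity)

lemma auxN_sum : ∑ a : F, (auxN a : ℝ) = (Fintype.card F : ℝ) ^ 3 := by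
  have := Finset.card_eq_sum_card_fiberwise (s := (Finset.univ : Finset (F × F × F)))
      (t := Finset.univ) (f := fun v : F × F × F => v.1 ^ 3 + v.2.1 ^ 3 + v.2.2 ^ 3) (by simp)
  rw [Finset.card_univ, Fintype.card_prod, Fintype.card_prod] at this
  have h : ∑ a : F, auxN a = Fintype.card F ^ 3 := by
    unfold auxN; rw [← this]; ring
  exact_mod_cast h

end Fourier

section Local
variable {F : Type} [Field F] [Fintype F] [DecidableEq F]
variable {R : Type} [CommRing R] [Fintype R] [DecidableEq R]

def auxFib (π : R →+* F) (a : F) : Finset R := Finset.univ.filter fun x => π x = a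

lemma mem_auxFib (π : R →+* F) (a : F) (x : R) : x ∈ auxFib π a ↔ π x = a := by
  simp [auxFib]

lemma auxFib_card (π : R →+* F) (hs : Function.Surjective π) (a : F) :
    (auxFib π a).card = (auxFib π 0).card := by
  obtain ⟨x0, hx0⟩ := hs a
  refine Finset.card_bij' (fun x _ => x - x0) (fun x _ => x + x0) ?_ ?_ ?_ ?_
  · intro x hx; rw [mem_auxFib] at *; simp [hx, hx0]
  · intro x hx; rw [mem_auxFib] at *; simp [hx, hx0]
  · intro x hx; simp
  · intro x hx; simp

lemma auxFib_total (π : R →+* F) (hs : Function.Surjective π) :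
    Fintype.card R = (auxFib π 0).card * Fintype.card F := by
  have := Finset.card_eq_sum_card_fiberwise (s := (Finset.univ : Finset R))
      (t := Finset.univ) (f := π) (by simp)
  rw [Finset.card_univ] at this
  have h : ∑ a : F, (auxFib π a).card = (auxFib π 0).card * Fintype.card F := by
    rw [Finset.sum_congr rfl (fun a _ => auxFib_card π hs a)]
    simp [mul_comm]
  rw [this, ← h]
  rfl

lemma aux_cube_lift (π : R →+* F) (hs : Function.Surjective π)
    (hu : ∀ x, π x ≠ 0 → IsUnit x) (h3 : (3 : F) ≠ 0) (x0 : F) (hx0 : x0 ≠ 0) (c : R)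
    (hc : π c = x0 ^ 3) : ∃ x, π x = x0 ∧ x ^ 3 = c := by
  have := Finset.surjOn_of_injOn_of_card_le (s := auxFib π x0) (t := auxFib π (x0 ^ 3))
    (fun x => x ^ 3) ?_ ?_ ?_
  · obtain ⟨x, hx, hxc⟩ := this (a := c) (by simp [mem_auxFib, hc])
    exact ⟨x, by simpa [mem_auxFib] using hx, hxc⟩
  · intro x hx
    simp only [Finset.mem_coe, mem_auxFib] at *
    rw [map_pow, hx]
  · intro x hx y hy hxy
    simp only [Finset.mem_coe, mem_auxFib] at *
    have h1 : (x ^ 2 + x * y + y ^ 2) * (x - y) = 0 := by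
      have : x ^ 3 = y ^ 3 := hxy
      linear_combination this
    have h2 : IsUnit (x ^ 2 + x * y + y ^ 2) := by
      apply hu
      have : π (x ^ 2 + x * y + y ^ 2) = 3 * x0 ^ 2 := by
        simp [hx, hy]; ring
      rw [this]
      exact mul_ne_zero h3 (pow_ne_zero _ hx0)
    exact sub_eq_zero.1 (h2.mul_right_eq_zero.1 h1)
  · rw [auxFib_card π hs, auxFib_card π hs x0]

lemma aux_lift_count (π : R →+* F) (hs : Function.Surjective π)
    (hu : ∀ x, π x ≠ 0 → IsUnit x) (h3 : (3 : F) ≠ 0) (k : R) (v : F × F × F) (hv : v ≠ 0)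
    (hk : v.1 ^ 3 + v.2.1 ^ 3 + v.2.2 ^ 3 = π k) :
    (auxFib π 0).card ^ 2 ≤ (Finset.univ.filter fun w : R × R × R =>
      w.1 ^ 3 + w.2.1 ^ 3 + w.2.2 ^ 3 = k ∧ (π w.1, π w.2.1, π w.2.2) = v).card := by
  obtain ⟨a, b, c⟩ := v
  have hex := aux_cube_lift π hs hu h3
  simp only at hk
  have hcard : ∀ s t : F, (auxFib π s ×ˢ auxFib π t).card = (auxFib π 0).card ^ 2 := by
    intro s t
    rw [Finset.card_product, auxFib_card π hs s, auxFib_card π hs t, sq]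
  by_cases ha : a = 0
  · by_cases hb : b = 0
    · have hc : c ≠ 0 := by
        rintro rfl
        exact hv (by simp [ha, hb])
      have : ∀ p : R × R, ∃ x, p ∈ auxFib π a ×ˢ auxFib π b →
          π x = c ∧ p.1 ^ 3 + p.2 ^ 3 + x ^ 3 = k := by
        intro p
        by_cases hp : p ∈ auxFib π a ×ˢ auxFib π b
        · rw [Finset.mem_product, mem_auxFib, mem_auxFib] at hp
          obtain ⟨x, h1, h2⟩ := hex c hc (k - p.1 ^ 3 - p.2 ^ 3) (by
            simp only [map_sub, map_pow, hp.1, hp.2, ← hk]; ring)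
          exact ⟨x, fun _ => ⟨h1, by rw [h2]; ring⟩⟩
        · exact ⟨0, fun h => absurd h hp⟩
      choose g hg using this
      rw [← hcard a b]
      refine Finset.card_le_card_of_injOn (fun p => (p.1, p.2, g p)) ?_ ?_
      · intro p hp
        have := hg p hp
        rw [Finset.mem_coe, Finset.mem_product, mem_auxFib, mem_auxFib] at hp
        simp [this.1, this.2, hp.1, hp.2]
      · intro p _ p' _ h
        simp only [Prod.mk.injEq] at h
        exact Prod.ext h.1 h.2.1
    · have : ∀ p : R × R, ∃ x, p ∈ auxFib π a ×ˢ auxFib π c →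
          π x = b ∧ p.1 ^ 3 + x ^ 3 + p.2 ^ 3 = k := by
        intro p
        by_cases hp : p ∈ auxFib π a ×ˢ auxFib π c
        · rw [Finset.mem_product, mem_auxFib, mem_auxFib] at hp
          obtain ⟨x, h1, h2⟩ := hex b hb (k - p.1 ^ 3 - p.2 ^ 3) (by
            simp only [map_sub, map_pow, hp.1, hp.2, ← hk]; ring)
          exact ⟨x, fun _ => ⟨h1, by rw [h2]; ring⟩⟩
        · exact ⟨0, fun h => absurd h hp⟩
      choose g hg using this
      rw [← hcard a c]
      refine Finset.card_le_card_of_injOn (fun p => (p.1, g p, p.2)) ?_ ?_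
      · intro p hp
        have := hg p hp
        rw [Finset.mem_coe, Finset.mem_product, mem_auxFib, mem_auxFib] at hp
        simp [this.1, this.2, hp.1, hp.2]
      · intro p _ p' _ h
        simp only [Prod.mk.injEq] at h
        exact Prod.ext h.1 h.2.2
  · have : ∀ p : R × R, ∃ x, p ∈ auxFib π b ×ˢ auxFib π c →
        π x = a ∧ x ^ 3 + p.1 ^ 3 + p.2 ^ 3 = k := by
      intro p
      by_cases hp : p ∈ auxFib π b ×ˢ auxFib π c
      · rw [Finset.mem_product, mem_auxFib, mem_auxFib] at hp
        obtain ⟨x, h1, h2⟩ := hex a ha (k - p.1 ^ 3 - p.2 ^ 3) (by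
          simp only [map_sub, map_pow, hp.1, hp.2, ← hk]; ring)
        exact ⟨x, fun _ => ⟨h1, by rw [h2]; ring⟩⟩
      · exact ⟨0, fun h => absurd h hp⟩
    choose g hg using this
    rw [← hcard b c]
    refine Finset.card_le_card_of_injOn (fun p => (g p, p.1, p.2)) ?_ ?_
    · intro p hp
      have := hg p hp
      rw [Finset.mem_coe, Finset.mem_product, mem_auxFib, mem_auxFib] at hp
      simp [this.1, this.2, hp.1, hp.2]
    · intro p _ p' _ h
      simp only [Prod.mk.injEq] at h
      exact Prod.ext h.2.1 h.2.2

def auxM (a : F) : ℕ :=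
  (Finset.univ.filter fun v : F × F × F =>
    v ≠ 0 ∧ v.1 ^ 3 + v.2.1 ^ 3 + v.2.2 ^ 3 = a).card

def auxRho (k : R) : ℕ :=
  (Finset.univ.filter fun v : R × R × R => v.1 ^ 3 + v.2.1 ^ 3 + v.2.2 ^ 3 = k).card

lemma auxN_le_auxM (a : F) : auxN a ≤ auxM a + 1 := by
  have h : (Finset.univ.filter fun v : F × F × F => v.1 ^ 3 + v.2.1 ^ 3 + v.2.2 ^ 3 = a)
      ⊆ insert 0 (Finset.univ.filter fun v : F × F × F =>
        v ≠ 0 ∧ v.1 ^ 3 + v.2.1 ^ 3 + v.2.2 ^ 3 = a) := by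
    intro v hv
    simp only [Finset.mem_insert, Finset.mem_filter, Finset.mem_univ, true_and] at *
    tauto
  exact (Finset.card_le_card h).trans (Finset.card_insert_le _ _)

lemma auxRho_ge (π : R →+* F) (hs : Function.Surjective π)
    (hu : ∀ x, π x ≠ 0 → IsUnit x) (h3 : (3 : F) ≠ 0) (k : R) :
    auxM (π k) * (auxFib π 0).card ^ 2 ≤ auxRho k := by
  unfold auxM auxRho
  set f : R × R × R → F × F × F := fun w => (π w.1, π w.2.1, π w.2.2) with hf
  rw [Finset.card_eq_sum_card_fiberwise (f := f) (t := Finset.univ) (by simp)]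
  rw [← smul_eq_mul]
  refine (Finset.card_nsmul_le_sum _ (fun v => (Finset.filter (fun w => f w = v)
    (Finset.univ.filter fun v : R × R × R => v.1 ^ 3 + v.2.1 ^ 3 + v.2.2 ^ 3 = k)).card)
    _ ?_).trans (Finset.sum_le_sum_of_subset (Finset.subset_univ _))
  intro v hv
  simp only [Finset.mem_filter, Finset.mem_univ, true_and] at hv
  rw [Finset.filter_filter]
  exact aux_lift_count π hs hu h3 k v hv.1 hv.2

lemma auxM_pos (π : R →+* F) (k : R) (hk : auxRho k ≠ 0) : 1 ≤ auxM (π k) := by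
  unfold auxM
  rw [Nat.one_le_iff_ne_zero, ← Nat.pos_iff_ne_zero, Finset.card_pos]
  by_cases h0 : π k = 0
  · exact ⟨(1, -1, 0), by simp [h0]; ring⟩
  · unfold auxRho at hk
    rw [← Nat.pos_iff_ne_zero, Finset.card_pos] at hk
    obtain ⟨w, hw⟩ := hk
    simp only [Finset.mem_filter, Finset.mem_univ, true_and] at hw
    refine ⟨(π w.1, π w.2.1, π w.2.2), ?_⟩
    have h1 : π w.1 ^ 3 + π w.2.1 ^ 3 + π w.2.2 ^ 3 = π k := by
      rw [← hw]; simp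
    simp only [Finset.mem_filter, Finset.mem_univ, true_and]
    refine ⟨?_, h1⟩
    intro h
    simp only [Prod.mk_eq_zero] at h
    rw [h.1, h.2.1, h.2.2] at h1
    exact h0 (by rw [← h1]; ring)

lemma auxM_sum_le : ∑ a : F, (Fintype.card F : ℝ) ^ 2 / (auxM a : ℝ)
    ≤ (Fintype.card F : ℝ) * (1 + 20000 ^ 4 * ((Fintype.card F : ℝ) ^ 2)⁻¹) := by
  have hvar := auxN_var (F := F)
  have hsum := auxN_sum (F := F)
  have hQ2 : (2 : ℝ) ≤ Fintype.card F := by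
    exact_mod_cast Fintype.one_lt_card (α := F)
  have hcard : (Finset.univ : Finset F).card = Fintype.card F := rfl
  set Q : ℝ := ((Fintype.card F : ℕ) : ℝ) with hQ
  have hQ0 : 0 < Q := by linarith
  by_cases hbig : Q ≤ 20000
  · calc ∑ a : F, Q ^ 2 / (auxM a : ℝ) ≤ ∑ a : F, Q ^ 2 := by
          refine Finset.sum_le_sum fun a _ => ?_
          rcases Nat.eq_zero_or_pos (auxM a) with h | h
          · rw [h]; simp; positivity
          · exact div_le_self (by positivity) (by exact_mod_cast h)
      _ = Q * (Q ^ 4 * (Q ^ 2)⁻¹) := by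
          rw [Finset.sum_const, hcard, nsmul_eq_mul, ← hQ]; field_simp
      _ ≤ Q * (1 + 20000 ^ 4 * (Q ^ 2)⁻¹) := by
          gcongr
          have : Q ^ 4 * (Q ^ 2)⁻¹ ≤ 20000 ^ 4 * (Q ^ 2)⁻¹ := by gcongr
          linarith
  · push Not at hbig
    have key : ∀ a : F, Q ^ 2 / (auxM a : ℝ) ≤
        2 - ((auxN a : ℝ) - 1) / Q ^ 2 + 4 / Q ^ 4 * ((auxN a : ℝ) - Q ^ 2) ^ 2 + 4 / Q ^ 4 := by
      intro a
      have hD : ((auxN a : ℝ) - Q ^ 2) ^ 2 ≤ 972 * Q ^ 3 :=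
        (Finset.single_le_sum (f := fun a : F => ((auxN a : ℝ) - Q ^ 2) ^ 2)
          (fun _ _ => by positivity) (Finset.mem_univ a)).trans hvar
      have hD2 : ((auxN a : ℝ) - Q ^ 2) ^ 2 ≤ (Q ^ 2 / 4) ^ 2 := by
        refine hD.trans ?_
        have : 0 ≤ Q ^ 3 * (Q - 15552) := mul_nonneg (by positivity) (by linarith)
        nlinarith
      have hD3 := (abs_le_of_sq_le_sq' hD2 (by positivity)).1
      have hMN : (auxN a : ℝ) ≤ auxM a + 1 := by exact_mod_cast auxN_le_auxM a
      set n : ℝ := (auxN a : ℝ)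
      have hn : Q ^ 2 / 2 ≤ n - 1 := by nlinarith
      have hq2 : 0 < Q ^ 2 := by positivity
      set m : ℝ := (n - 1) / Q ^ 2 with hm
      have hm2 : 1 / 2 ≤ m := by
        rw [hm, le_div_iff₀ hq2]; linarith
      have h1 : Q ^ 2 / (auxM a : ℝ) ≤ 1 / m := by
        rw [hm, one_div_div]
        apply div_le_div_of_nonneg_left hq2.le (by linarith) (by linarith)
      have h2 : 1 / m ≤ 2 - m + 2 * (m - 1) ^ 2 := by
        rw [div_le_iff₀ (by linarith)]
        nlinarith [mul_nonneg (sq_nonneg (m - 1)) (by linarith : 0 ≤ 2 * m - 1)]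
      have h3 : 2 * (m - 1) ^ 2 ≤ 4 / Q ^ 4 * (n - Q ^ 2) ^ 2 + 4 / Q ^ 4 := by
        have e : 2 * (m - 1) ^ 2 = 2 / Q ^ 4 * ((n - Q ^ 2) - 1) ^ 2 := by
          rw [hm]; field_simp; ring
        have e2 : 4 / Q ^ 4 * (n - Q ^ 2) ^ 2 + 4 / Q ^ 4
          = 2 / Q ^ 4 * (2 * (n - Q ^ 2) ^ 2 + 2) := by ring
        rw [e, e2]
        gcongr
        nlinarith [sq_nonneg (n - Q ^ 2 + 1)]
      linarith
    refine (Finset.sum_le_sum fun a _ => key a).trans ?_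
    rw [Finset.sum_add_distrib, Finset.sum_add_distrib, Finset.sum_sub_distrib,
      ← Finset.mul_sum, ← Finset.sum_div, Finset.sum_sub_distrib, hsum]
    simp only [Finset.sum_const, hcard, nsmul_eq_mul, ← hQ]
    have h4 : 4 / Q ^ 4 * ∑ a : F, ((auxN a : ℝ) - Q ^ 2) ^ 2 ≤ 4 / Q ^ 4 * (972 * Q ^ 3) := by
      gcongr
    have h5 : 4 / Q ^ 4 * (972 * Q ^ 3) = 3888 / Q := by field_simp; norm_num
    have h6 : (Q ^ 3 - Q * 1) / Q ^ 2 = Q - 1 / Q := by field_simp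
    have h7 : Q * (4 / Q ^ 4) ≤ 4 / Q := by
      rw [show Q * (4 / Q ^ 4) = 4 / Q ^ 3 by field_simp]
      gcongr
      nlinarith [sq_nonneg Q]
    have h8 : Q * (1 + 20000 ^ 4 * (Q ^ 2)⁻¹) = Q + 20000 ^ 4 / Q := by field_simp
    rw [h6, h8]
    have h9 : 1 / Q + 3888 / Q + 4 / Q ≤ 20000 ^ 4 / Q := by
      rw [← add_div, ← add_div]
      gcongr
      norm_num
    linarith

lemma aux_main (π : R →+* F) (hs : Function.Surjective π)
    (hu : ∀ x, π x ≠ 0 → IsUnit x) (h3 : (3 : F) ≠ 0) :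
    ∑ k : R, 1 / ((auxRho k : ℝ) / (Fintype.card R : ℝ) ^ 2)
    ≤ (Fintype.card R : ℝ) * (1 + 20000 ^ 4 * (Fintype.card F : ℝ) ^ (-(3 / 2) : ℝ)) := by
  have hQ2 : (2 : ℝ) ≤ Fintype.card F := by
    exact_mod_cast Fintype.one_lt_card (α := F)
  have hm0 : 0 < (auxFib π 0).card := Finset.card_pos.2 ⟨0, by simp [mem_auxFib]⟩
  have htot : (Fintype.card R : ℝ) = (auxFib π 0).card * Fintype.card F := by
    exact_mod_cast auxFib_total π hs
  have key : ∀ k : R, 1 / ((auxRho k : ℝ) / (Fintype.card R : ℝ) ^ 2)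
      ≤ (Fintype.card F : ℝ) ^ 2 / auxM (π k) := by
    intro k
    rw [one_div_div]
    by_cases h0 : auxRho k = 0
    · rw [h0]; simp; positivity
    have h1 : (1 : ℝ) ≤ auxM (π k) := by exact_mod_cast auxM_pos π k h0
    have h2 : (auxM (π k) : ℝ) * ((auxFib π 0).card : ℝ) ^ 2 ≤ auxRho k := by
      exact_mod_cast auxRho_ge π hs hu h3 k
    have hm : (0 : ℝ) < (auxFib π 0).card := by exact_mod_cast hm0
    calc _ ≤ (Fintype.card R : ℝ) ^ 2 / ((auxM (π k) : ℝ) * ((auxFib π 0).card : ℝ) ^ 2) := by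
          gcongr
      _ = _ := by rw [htot]; field_simp
  refine (Finset.sum_le_sum fun k _ => key k).trans ?_
  have h1 : ∑ k : R, (Fintype.card F : ℝ) ^ 2 / (auxM (π k) : ℝ)
      = ((auxFib π 0).card : ℝ) * ∑ a : F, (Fintype.card F : ℝ) ^ 2 / (auxM a : ℝ) := by
    rw [← Finset.sum_fiberwise (s := Finset.univ) (g := π), Finset.mul_sum]
    refine Finset.sum_congr rfl fun a _ => ?_
    rw [← auxFib_card π hs a, ← nsmul_eq_mul, ← Finset.sum_const]
    refine Finset.sum_congr rfl fun x hx => ?_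
    replace hx := (mem_auxFib π a x).1 hx
    rw [hx]
  rw [h1, htot, mul_assoc]
  gcongr
  refine auxM_sum_le.trans ?_
  gcongr
  rw [← Real.rpow_natCast, ← Real.rpow_neg (by positivity)]
  apply Real.rpow_le_rpow_of_exponent_le (by linarith)
  norm_num

end Local

section Bridge
variable {Fq : Type} [Field Fq] [Fintype Fq]

lemma aux_bij (N : Polynomial Fq) (hN : N.Monic) (n : ℕ) (hn : N.natDegree = n) :
    Function.Bijective (fun v : Fin n → Fq => Ideal.Quotient.mk (Ideal.span {N})
      (∑ i : Fin n, Polynomial.C (v i) * X ^ (i : ℕ))) := by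
  have hcoeff : ∀ (v : Fin n → Fq) (i : Fin n),
      (∑ i : Fin n, Polynomial.C (v i) * X ^ (i : ℕ)).coeff i = v i := by
    intro v i
    simp [Polynomial.coeff_X_pow, ← Fin.ext_iff]
  have hNdeg : N.degree = n := by
    rw [Polynomial.degree_eq_natDegree hN.ne_zero, hn]
  have hdeg : ∀ v : Fin n → Fq,
      (∑ i : Fin n, Polynomial.C (v i) * X ^ (i : ℕ)).degree < N.degree := by
    intro v
    rw [hNdeg]
    refine (Polynomial.degree_sum_le _ _).trans_lt ?_
    rw [Finset.sup_lt_iff (by exact WithBot.bot_lt_coe n)]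
    intro i _
    refine (Polynomial.degree_C_mul_X_pow_le _ _).trans_lt ?_
    exact_mod_cast i.2
  constructor
  · intro v w h
    simp only at h
    rw [Ideal.Quotient.eq, Ideal.mem_span_singleton] at h
    have h0 := Polynomial.eq_zero_of_dvd_of_degree_lt h
      ((Polynomial.degree_sub_le _ _).trans_lt (max_lt (hdeg v) (hdeg w)))
    funext i
    rw [← hcoeff v i, ← hcoeff w i, sub_eq_zero.1 h0]
  · intro r
    obtain ⟨p, rfl⟩ := Ideal.Quotient.mk_surjective r
    refine ⟨fun i => (p %ₘ N).coeff i, ?_⟩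
    simp only
    have h1 : ∑ i : Fin n, Polynomial.C ((p %ₘ N).coeff i) * X ^ (i : ℕ) = p %ₘ N := by
      ext j
      by_cases hj : j < n
      · exact hcoeff (fun i => (p %ₘ N).coeff i) ⟨j, hj⟩
      · have hj' : N.degree ≤ (j : WithBot ℕ) := by
          rw [hNdeg]; exact_mod_cast not_lt.1 hj
        rw [Polynomial.coeff_eq_zero_of_degree_lt ((hdeg _).trans_le hj'),
          Polynomial.coeff_eq_zero_of_degree_lt
            ((Polynomial.degree_modByMonic_lt p hN).trans_le hj')]
    rw [h1, Ideal.Quotient.eq, Ideal.mem_span_singleton]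
    refine ⟨-(p /ₘ N), ?_⟩
    have := Polynomial.modByMonic_add_div p N
    linear_combination this

lemma aux_three (h : ringChar Fq ≠ 3) : (3 : Fq) ≠ 0 := by
  intro h0
  have h1 : ringChar Fq ∣ 3 := (ringChar.spec Fq 3).1 (by exact_mod_cast h0)
  rcases (Nat.dvd_prime Nat.prime_three).1 h1 with h2 | h2
  · exact CharP.ringChar_ne_one h2
  · exact h h2

end Bridge

theorem sum_inv_rhoTilde_prime_power_le :
    ∃ C : ℝ, 0 < C ∧ ∀ (Fq : Type) [Field Fq] [Fintype Fq], ringChar Fq ≠ 3 →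
      ∀ ϖ : Polynomial Fq, ϖ.Monic → Irreducible ϖ → ∀ e : ℕ, 1 ≤ e →
        ∑ v : Fin (e * ϖ.natDegree) → Fq,
            1 / rhoTilde Fq (ϖ ^ e)
              (∑ i : Fin (e * ϖ.natDegree), Polynomial.C (v i) * X ^ (i : ℕ)) ≤
          ((Fintype.card Fq : ℝ) ^ ϖ.natDegree) ^ e *
            (1 + C * ((Fintype.card Fq : ℝ) ^ ϖ.natDegree) ^ (-(3 / 2) : ℝ)) := by
  classical
  refine ⟨20000 ^ 4, by norm_num, ?_⟩
  intro Fq _ _ hchar ϖ hmon hirr e he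
  have hdegN : (ϖ ^ e).natDegree = e * ϖ.natDegree := Polynomial.natDegree_pow _ _
  have hbij := aux_bij (ϖ ^ e) (hmon.pow e) _ hdegN
  have hbij1 := aux_bij ϖ hmon _ rfl
  have hmax : (Ideal.span {ϖ}).IsMaximal :=
    PrincipalIdealRing.isMaximal_of_irreducible hirr
  let : Field (Polynomial Fq ⧸ Ideal.span {ϖ}) := Ideal.Quotient.field _
  have : Finite (Polynomial Fq ⧸ Ideal.span {ϖ}) := Finite.of_surjective _ hbij1.2
  have : Finite (Polynomial Fq ⧸ Ideal.span {ϖ ^ e}) := Finite.of_surjective _ hbij.2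
  let : Fintype (Polynomial Fq ⧸ Ideal.span {ϖ}) := Fintype.ofFinite _
  let : Fintype (Polynomial Fq ⧸ Ideal.span {ϖ ^ e}) := Fintype.ofFinite _
  have hcR : Fintype.card (Polynomial Fq ⧸ Ideal.span {ϖ ^ e})
      = (Fintype.card Fq ^ ϖ.natDegree) ^ e := by
    rw [← Fintype.card_of_bijective hbij]
    simp [← pow_mul, mul_comm]
  have hcF : Fintype.card (Polynomial Fq ⧸ Ideal.span {ϖ})
      = Fintype.card Fq ^ ϖ.natDegree := by
    rw [← Fintype.card_of_bijective hbij1]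
    simp
  have hle : Ideal.span {ϖ ^ e} ≤ Ideal.span {ϖ} := by
    rw [Ideal.span_singleton_le_span_singleton]
    exact dvd_pow_self _ (by omega)
  have hs : Function.Surjective (Ideal.Quotient.factor hle) := Ideal.Quotient.factor_surjective hle
  have hu : ∀ x, Ideal.Quotient.factor hle x ≠ 0 → IsUnit x := by
    intro x hx
    obtain ⟨p, rfl⟩ := Ideal.Quotient.mk_surjective x
    rw [Ideal.Quotient.factor_mk, Ne, Ideal.Quotient.eq_zero_iff_mem,
      Ideal.mem_span_singleton] at hx
    have hcop : IsCoprime (ϖ ^ e) p := ((hirr.coprime_iff_not_dvd).2 hx).pow_left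
    obtain ⟨a, b, hab⟩ := hcop
    refine IsUnit.of_mul_eq_one (Ideal.Quotient.mk _ b) ?_
    rw [← map_mul, ← map_one (Ideal.Quotient.mk _), Ideal.Quotient.eq, Ideal.mem_span_singleton]
    exact ⟨-a, by linear_combination hab⟩
  have h3 : (3 : Polynomial Fq ⧸ Ideal.span {ϖ}) ≠ 0 := by
    have h := aux_three hchar
    intro h0
    apply h
    have : algebraMap Fq (Polynomial Fq ⧸ Ideal.span {ϖ}) 3 = 0 := by
      rw [map_ofNat]; exact h0
    exact (map_eq_zero_iff _ (algebraMap Fq (Polynomial Fq ⧸ Ideal.span {ϖ})).injective).1 this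
  have hmain := aux_main (Ideal.Quotient.factor hle) hs hu h3
  rw [hcR, hcF] at hmain
  push_cast at hmain
  refine le_trans (le_of_eq ?_) hmain
  refine Fintype.sum_bijective _ hbij _ _ fun v => ?_
  unfold rhoTilde auxRho
  rw [Nat.card_eq_fintype_card, Fintype.card_subtype, hdegN, ← pow_mul _ ϖ.natDegree e, mul_comm ϖ.natDegree e]
end

section
/- Let F be a finite field with r = |F| ≡ 1 (mod 3), and let χ be a complex multiplicative character of F of exact order 3 (extended by χ(0) = 0). Then for every k ∈ F with k ≠ 0, #{(x,y,z) ∈ F³ : x³ + y³ + z³ = k} = r² + 3·(χ(k) + conj(χ(k)))·r − 2·Re(J(χ,χ)). -/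
open Finset in
lemma aux_count {F : Type*} [Field F] [Fintype F] [DecidableEq F]
    (hcard : Fintype.card F % 3 = 1)
    (χ : MulChar F ℂ) (hχ : orderOf χ = 3) (a : F) :
    ((univ.filter (fun x : F => x ^ 3 = a)).card : ℂ) = 1 + χ a + χ⁻¹ a := by
  have hχ3 : χ ^ 3 = 1 := hχ ▸ pow_orderOf_eq_one χ
  have hinv : χ⁻¹ = χ ^ 2 := by
    rw [inv_eq_iff_mul_eq_one, ← pow_succ']; exact hχ3
  rcases eq_or_ne a 0 with rfl | ha
  · have : (univ.filter (fun x : F => x ^ 3 = 0)) = {0} := by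
      ext x; simp
    rw [this]; simp [MulChar.map_zero]
  have hne : χ ≠ 1 := by
    rintro rfl; simp at hχ
  obtain ⟨g, hg⟩ := IsCyclic.exists_generator (α := Fˣ)
  have hgord : orderOf g = Fintype.card F - 1 := by
    rw [orderOf_eq_card_of_forall_mem_zpowers hg, Nat.card_eq_fintype_card, Fintype.card_units]
  have h1 : 1 < Fintype.card F := Fintype.one_lt_card
  obtain ⟨m, hm⟩ : 3 ∣ Fintype.card F - 1 := by omega
  have hprim : IsPrimitiveRoot ((g : F) ^ m) 3 := by
    have h0 : IsPrimitiveRoot (g : F) (Fintype.card F - 1) := by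
      rw [← hgord, IsPrimitiveRoot.coe_units_iff]; exact IsPrimitiveRoot.orderOf g
    exact h0.pow (by omega) (by rw [hm, mul_comm])
  have hfilter : (univ.filter (fun x : F => x ^ 3 = a)) = (Polynomial.nthRoots 3 a).toFinset := by
    ext x; simp [Polynomial.mem_nthRoots]
  have hcardroots : (univ.filter (fun x : F => x ^ 3 = a)).card
      = if ∃ α : F, α ^ 3 = a then 3 else 0 := by
    rw [hfilter, Multiset.toFinset_card_of_nodup (hprim.nthRoots_nodup ha), hprim.card_nthRoots]
    congr
  have hpow : ∀ b : F, b ≠ 0 → χ b ^ 3 = 1 := by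
    intro b hb
    rw [← MulChar.pow_apply' χ (by norm_num), hχ3, MulChar.one_apply hb.isUnit]
  have hg1 : χ g ≠ 1 := by
    intro h
    apply hne
    rw [MulChar.eq_iff hg, h]; simp
  rw [hcardroots, hinv, MulChar.pow_apply' χ (by norm_num)]
  split_ifs with h
  · obtain ⟨b, rfl⟩ := h
    have hb : b ≠ 0 := by rintro rfl; simp at ha
    rw [map_pow, hpow b hb]; norm_num
  · have hna : χ a ≠ 1 := by
      intro h1
      apply h
      obtain ⟨n, hn⟩ := Subgroup.mem_zpowers_iff.mp (hg (Units.mk0 a ha))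
      have hprimg : IsPrimitiveRoot (χ g) 3 := by
        refine IsPrimitiveRoot.iff_orderOf.mpr ?_
        have : Fact (Nat.Prime 3) := ⟨Nat.prime_three⟩
        exact orderOf_eq_prime (hpow g g.ne_zero) hg1
      have hz : (χ g) ^ n = 1 := by
        rw [← h1, ← Units.val_mk0 ha, ← hn, ← MulChar.coe_toUnitHom, ← MulChar.coe_toUnitHom,
          map_zpow]; simp
      obtain ⟨j, hj⟩ := (hprimg.zpow_eq_one_iff_dvd n).mp hz
      refine ⟨((g ^ j : Fˣ) : F), ?_⟩
      rw [← Units.val_mk0 ha, ← hn, hj, ← Units.val_pow_eq_pow_val, ← zpow_natCast, ← zpow_mul,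
        mul_comm, Nat.cast_ofNat]
    have h3 := hpow a ha
    have : (χ a - 1) * (1 + χ a + χ a ^ 2) = 0 := by ring_nf; rw [h3]; ring
    rcases mul_eq_zero.mp this with h | h
    · exact absurd (sub_eq_zero.mp h) hna
    · simp [h]

lemma aux_conv {F : Type*} [Field F] [Fintype F] (α β : MulChar F ℂ) (t : F) (ht : t ≠ 0) :
    ∑ a, α a * β (t - a) = (α * β) t * jacobiSum α β := by
  rw [jacobiSum, Finset.mul_sum, ← Equiv.sum_comp (Equiv.mulLeft₀ t ht)]
  refine Finset.sum_congr rfl fun x _ => ?_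
  change α (t * x) * β (t - t * x) = _
  rw [show t - t * x = t * (1 - x) by ring, map_mul, map_mul,
    MulChar.mul_apply]
  ring

lemma aux_conv0 {F : Type*} [Field F] [Fintype F] (α β : MulChar F ℂ) :
    ∑ a, α a * β (0 - a) = β (-1) * ∑ a, (α * β) a := by
  rw [Finset.mul_sum]
  refine Finset.sum_congr rfl fun x _ => ?_
  rw [show 0 - x = -1 * x by ring, map_mul, MulChar.mul_apply]
  ring

lemma aux_shift {F : Type*} [Field F] [Fintype F] (β : MulChar F ℂ) (hβ : β ≠ 1) (t : F) :
    ∑ a, β (t - a) = 0 := by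
  rw [← MulChar.sum_eq_zero_of_ne_one hβ]
  exact Equiv.sum_comp (Equiv.subLeft t) (fun a => β a)

open Finset in
lemma aux_total {F : Type*} [Field F] [Fintype F] [DecidableEq F] (k : F) :
    (Nat.card {v : F × F × F // v.1 ^ 3 + v.2.1 ^ 3 + v.2.2 ^ 3 = k} : ℂ) =
     ∑ t : F, (∑ a : F, ((univ.filter (fun x : F => x ^ 3 = a)).card : ℂ) *
       ((univ.filter (fun x : F => x ^ 3 = t - a)).card : ℂ)) *
       ((univ.filter (fun x : F => x ^ 3 = k - t)).card : ℂ) := by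
  have key : ∀ (f : F → ℂ), ∑ a : F, ((univ.filter (fun x : F => x ^ 3 = a)).card : ℂ) * f a
      = ∑ x : F, f (x ^ 3) := by
    intro f
    rw [← Finset.sum_fiberwise univ (fun x : F => x ^ 3) (fun x => f (x ^ 3))]
    refine Finset.sum_congr rfl fun a _ => ?_
    rw [Finset.sum_congr rfl (g := fun _ => f a) (fun x hx => by rw [(mem_filter.mp hx).2])]
    simp
  simp_rw [key, Finset.sum_mul]
  rw [Finset.sum_comm]
  have h2 : ∀ x : F, ∑ t : F, ((univ.filter (fun y : F => y ^ 3 = t - x ^ 3)).card : ℂ) *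
       ((univ.filter (fun z : F => z ^ 3 = k - t)).card : ℂ) =
       ∑ y : F, ((univ.filter (fun z : F => z ^ 3 = k - (y ^ 3 + x ^ 3))).card : ℂ) := by
    intro x
    rw [← key (fun a => ((univ.filter (fun z : F => z ^ 3 = k - (a + x ^ 3))).card : ℂ)),
      ← Equiv.sum_comp (Equiv.addRight (x ^ 3))]
    simp
    congr!
  simp_rw [h2]
  rw [Nat.card_eq_fintype_card, Fintype.card_subtype, Finset.card_filter]
  simp_rw [Finset.card_filter]
  push_cast
  rw [Fintype.sum_prod_type]
  refine Finset.sum_congr rfl fun x _ => ?_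
  rw [Fintype.sum_prod_type]
  refine Finset.sum_congr rfl fun y _ => Finset.sum_congr rfl fun z _ => ?_
  congr 1
  rw [eq_sub_iff_add_eq, eq_iff_iff]
  dsimp only
  rw [show x ^ 3 + y ^ 3 + z ^ 3 = z ^ 3 + (y ^ 3 + x ^ 3) by ring]

theorem count_sum_three_cubes_eq (F : Type*) [Field F] [Fintype F]
    (hcard : Fintype.card F % 3 = 1)
    (χ : MulChar F ℂ) (hχ : orderOf χ = 3) (k : F) (hk : k ≠ 0) :
    (Nat.card {v : F × F × F // v.1 ^ 3 + v.2.1 ^ 3 + v.2.2 ^ 3 = k} : ℂ) =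
      (Fintype.card F : ℂ) ^ 2 +
        3 * (χ k + (starRingEnd ℂ) (χ k)) * (Fintype.card F : ℂ) -
        2 * ((jacobiSum χ χ).re : ℂ) := by
  classical
  have hχ3 : χ ^ 3 = 1 := hχ ▸ pow_orderOf_eq_one χ
  have hinv : χ⁻¹ = χ * χ := by
    rw [inv_eq_iff_mul_eq_one, ← pow_two, ← pow_succ']; exact hχ3
  have hinv' : χ⁻¹ * χ⁻¹ = χ := by
    nth_rewrite 1 [hinv]; simp
  have hne : χ ≠ 1 := by
    rintro rfl; simp at hχ
  have hne' : χ⁻¹ ≠ 1 := by simpa using hne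
  have hneg : χ (-1) = 1 := MulChar.val_neg_one_eq_one_of_odd_order (n := 3) (by decide) hχ3
  have hneg' : χ⁻¹ (-1) = 1 := by rw [hinv, MulChar.mul_apply, hneg, mul_one]
  have hconj : ∀ a, (starRingEnd ℂ) (χ a) = χ⁻¹ a := fun a => MulChar.star_apply' χ a
  have hJconj : (starRingEnd ℂ) (jacobiSum χ χ) = jacobiSum χ⁻¹ χ⁻¹ := by
    simp [jacobiSum, hconj]
  have hJJ : jacobiSum χ χ * jacobiSum χ⁻¹ χ⁻¹ = Fintype.card F := by
    refine jacobiSum_mul_jacobiSum_inv ?_ hne hne (hinv ▸ hne')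
    rw [ringChar.eq_zero]
    exact fun h => CharP.ringChar_ne_zero_of_finite F h.symm
  have hre : 2 * ((jacobiSum χ χ).re : ℂ) = jacobiSum χ χ + jacobiSum χ⁻¹ χ⁻¹ := by
    rw [← hJconj, Complex.add_conj]; push_cast; ring
  -- convolutions
  have c11 : ∀ t, ∑ a, χ a * χ (t - a) = χ⁻¹ t * jacobiSum χ χ := by
    intro t
    rcases eq_or_ne t 0 with rfl | ht
    · rw [aux_conv0, ← hinv, MulChar.sum_eq_zero_of_ne_one hne', MulChar.map_zero]; simp
    · rw [aux_conv _ _ _ ht, ← hinv]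
  have c22 : ∀ t, ∑ a, χ⁻¹ a * χ⁻¹ (t - a) = χ t * jacobiSum χ⁻¹ χ⁻¹ := by
    intro t
    rcases eq_or_ne t 0 with rfl | ht
    · rw [aux_conv0, hinv', MulChar.sum_eq_zero_of_ne_one hne, MulChar.map_zero]; simp
    · rw [aux_conv _ _ _ ht, hinv']
  have hunits : ((Fintype.card Fˣ : ℕ) : ℂ) = Fintype.card F - 1 := by
    rw [Fintype.card_units, Nat.cast_sub Fintype.card_pos]; simp
  have c12 : ∀ t, ∑ a, χ a * χ⁻¹ (t - a) = (if t = 0 then (Fintype.card F : ℂ) else 0) - 1 := by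
    intro t
    rcases eq_or_ne t 0 with rfl | ht
    · rw [aux_conv0, mul_inv_cancel, MulChar.sum_one_eq_card_units, hneg', hunits]; simp
    · rw [aux_conv _ _ _ ht, mul_inv_cancel, MulChar.one_apply ht.isUnit,
        jacobiSum_nontrivial_inv hne, hneg]; simp [ht]
  have c21 : ∀ t, ∑ a, χ⁻¹ a * χ (t - a) = (if t = 0 then (Fintype.card F : ℂ) else 0) - 1 := by
    intro t
    rw [← c12 t, ← (Equiv.subLeft t).sum_comp]
    simp [mul_comm]
  have s1 := MulChar.sum_eq_zero_of_ne_one hne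
  have s2 := MulChar.sum_eq_zero_of_ne_one hne'
  have s3 := aux_shift χ hne
  have s4 := aux_shift χ⁻¹ hne'
  rw [aux_total]
  simp_rw [aux_count hcard χ hχ]
  have hM : ∀ t : F, ∑ a, (1 + χ a + χ⁻¹ a) * (1 + χ (t - a) + χ⁻¹ (t - a)) =
      Fintype.card F + χ⁻¹ t * jacobiSum χ χ + χ t * jacobiSum χ⁻¹ χ⁻¹ +
        2 * ((if t = 0 then (Fintype.card F : ℂ) else 0) - 1) := by
    intro t
    have : ∀ a, (1 + χ a + χ⁻¹ a) * (1 + χ (t - a) + χ⁻¹ (t - a)) =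
      1 + χ (t - a) + χ⁻¹ (t - a) + χ a + χ⁻¹ a + χ a * χ (t - a) + χ⁻¹ a * χ⁻¹ (t - a)
        + χ a * χ⁻¹ (t - a) + χ⁻¹ a * χ (t - a) := fun a => by ring
    simp_rw [this, Finset.sum_add_distrib, c11, c22, c12, c21, s1, s2, s3, s4]
    simp
    ring
  simp_rw [hM]
  generalize hJ : jacobiSum χ χ = J at *
  generalize hJ' : jacobiSum χ⁻¹ χ⁻¹ = J' at *
  have : ∀ t, ((Fintype.card F : ℂ) + χ⁻¹ t * J + χ t * J' +
        2 * ((if t = 0 then (Fintype.card F : ℂ) else 0) - 1)) * (1 + χ (k - t) + χ⁻¹ (k - t)) =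
      (Fintype.card F - 2 : ℂ) * 1 + (Fintype.card F - 2 : ℂ) * χ (k - t) +
      (Fintype.card F - 2 : ℂ) * χ⁻¹ (k - t) + J * χ⁻¹ t + J * (χ⁻¹ t * χ (k - t)) +
      J * (χ⁻¹ t * χ⁻¹ (k - t)) + J' * χ t + J' * (χ t * χ (k - t)) + J' * (χ t * χ⁻¹ (k - t)) +
      (if t = 0 then 2 * (Fintype.card F : ℂ) * (1 + χ (k - t) + χ⁻¹ (k - t)) else 0) := by
    intro t; split_ifs <;> ring
  simp_rw [this, Finset.sum_add_distrib, ← Finset.mul_sum, c11, c22, c12, c21, s1, s2, s3, s4]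
  rw [Finset.sum_ite_eq' Finset.univ (0 : F), hre, hconj]
  simp only [Finset.sum_const, Finset.card_univ, hk, if_false, Finset.mem_univ, if_true, sub_zero,
    nsmul_eq_mul]
  linear_combination (χ k + χ⁻¹ k) * hJJ
end

section
/- Suppose char(F_q) ≠ 3. Let Ã ≥ 1 be an integer and let m ∈ F_q[s] be a polynomial divisible by s^{3Ã−2}. Then the number of triples (x₁,x₂,x₃) of nonzero elements of R = F_q[s]/(s^{7Ã+2}) with x₁³ + x₂³ + x₃³ equal to the image of m in R, v_s(x₁) = v_s(x₂) ≤ Ã, and v_s(x₂) ≤ v_s(x₃) ≤ v_s(x₂) + 1, is at least Ã·q^{14Ã}. -/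
open Polynomial

/-- The `s`-adic valuation of an element of `F_q[s]/(s^c)`: the largest `n` such that
`s^n` divides it (for a nonzero element this is the multiplicity of `s` in the unique
representative of degree less than `c`). -/
noncomputable def vs {Fq : Type*} [Field Fq] (c : ℕ)
    (x : Polynomial Fq ⧸ Ideal.span {(X : Polynomial Fq) ^ c}) : ℕ :=
  sSup {n : ℕ | (Ideal.Quotient.mk (Ideal.span {(X : Polynomial Fq) ^ c}) X) ^ n ∣ x}

lemma hensel_aux {F : Type*} [Field F] (h3 : (3 : F) ≠ 0) (p : F[X]) (hp : p.coeff 0 = 1)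
    (n : ℕ) : ∃ Y : F[X], Y.coeff 0 = -1 ∧ (X : F[X]) ^ (n + 1) ∣ Y ^ 3 + p := by
  induction n with
  | zero =>
    refine ⟨-1, by simp, ?_⟩
    rw [zero_add, pow_one, X_dvd_iff]
    have : (-1 : F[X]) ^ 3 = -1 := by ring
    rw [this]; simp [hp]
  | succ n ih =>
    obtain ⟨Y, hY, k, hk⟩ := ih
    refine ⟨Y + X ^ (n + 1) * C (-(k.coeff 0) / 3), ?_, ?_⟩
    · rw [coeff_add, mul_coeff_zero, coeff_X_pow]; simp [hY]
    · set z : F[X] := C (-(k.coeff 0) / 3) with hz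
      have e : (Y + X ^ (n + 1) * z) ^ 3 + p = X ^ (n + 1) *
          (k + 3 * Y ^ 2 * z + X * (X ^ n * (3 * Y * z ^ 2 + X ^ (n + 1) * z ^ 3))) := by
        linear_combination hk
      rw [e, pow_succ _ (n + 1)]
      apply mul_dvd_mul_left
      apply dvd_add _ (dvd_mul_right _ _)
      rw [X_dvd_iff]
      have : (3 : F[X]) = C 3 := rfl
      rw [coeff_add, mul_coeff_zero, mul_coeff_zero, this, pow_two, mul_coeff_zero, hY, hz,
        coeff_C_zero, coeff_C_zero]
      field_simp
      ring

lemma mk_dvd_aux {F : Type*} [Field F] (c a n : ℕ) (hac : a < c) (r : F[X])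
    (hr : r.coeff 0 ≠ 0)
    (h : (Ideal.Quotient.mk (Ideal.span {(X : F[X]) ^ c}) X) ^ n ∣
      Ideal.Quotient.mk (Ideal.span {(X : F[X]) ^ c}) (X ^ a * r)) : n ≤ a := by
  by_contra hn
  push Not at hn
  obtain ⟨k, hk⟩ := h
  obtain ⟨k, rfl⟩ := Ideal.Quotient.mk_surjective k
  rw [← map_pow, ← map_mul, Ideal.Quotient.eq, Ideal.mem_span_singleton] at hk
  have h1 : (X : F[X]) ^ (a + 1) ∣ X ^ a * r - X ^ n * k := (pow_dvd_pow _ hac).trans hk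
  have h2 : (X : F[X]) ^ (a + 1) ∣ X ^ n * k := (pow_dvd_pow _ hn).mul_right _
  have h3 := (dvd_sub_left h2).1 h1
  rw [pow_succ, mul_dvd_mul_iff_left (pow_ne_zero _ X_ne_zero), X_dvd_iff] at h3
  exact hr h3

lemma vs_aux {F : Type*} [Field F] (c a : ℕ) (hac : a < c) (r : F[X])
    (hr : r.coeff 0 ≠ 0) :
    vs c (Ideal.Quotient.mk (Ideal.span {(X : F[X]) ^ c}) (X ^ a * r)) = a := by
  apply IsGreatest.csSup_eq
  refine ⟨?_, fun n hn => mk_dvd_aux c a n hac r hr hn⟩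
  rw [Set.mem_setOf_eq]
  rw [map_mul, map_pow]
  exact dvd_mul_right _ _

lemma ne_zero_aux {F : Type*} [Field F] (c a : ℕ) (hac : a < c) (r : F[X])
    (hr : r.coeff 0 ≠ 0) :
    Ideal.Quotient.mk (Ideal.span {(X : F[X]) ^ c}) (X ^ a * r) ≠ 0 := by
  intro h
  have := mk_dvd_aux c a (a + 1) hac r hr (by rw [h]; exact dvd_zero _)
  omega

noncomputable def polyOf {F : Type*} [Field F] (n : ℕ) (f : Fin n → F) : F[X] :=
  ((degreeLTEquiv F n).symm f : F[X])

lemma polyOf_inj {F : Type*} [Field F] (c b n : ℕ) (hc : b + n = c) (f g : Fin n → F)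
    (h : (X : F[X]) ^ c ∣ X ^ b * (polyOf n f - polyOf n g)) : f = g := by
  rw [← hc, pow_add, mul_dvd_mul_iff_left (pow_ne_zero _ X_ne_zero)] at h
  have hd : (polyOf n f - polyOf n g).degree < (n : ℕ) := by
    rw [← mem_degreeLT]
    exact Submodule.sub_mem _ (Subtype.property _) (Subtype.property _)
  have h0 := eq_zero_of_dvd_of_degree_lt h (by rwa [degree_X_pow])
  rw [sub_eq_zero] at h0
  exact (degreeLTEquiv F n).symm.injective (Subtype.ext h0)

/-- Suppose `char(F_q) ≠ 3`. Let `At ≥ 1` be an integer and `m ∈ F_q[s]` divisible by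
`s^{3At−2}`. Then the number of triples `(x₁,x₂,x₃)` of nonzero elements of
`R = F_q[s]/(s^{7At+2})` with `x₁³ + x₂³ + x₃³` equal to the image of `m`,
`v_s(x₁) = v_s(x₂) ≤ At` and `v_s(x₂) ≤ v_s(x₃) ≤ v_s(x₂) + 1`, is at least `At·q^{14At}`. -/
theorem count_valuation_solutions_ge (Fq : Type*) [Field Fq] [Fintype Fq]
    (hchar : ringChar Fq ≠ 3) (At : ℕ) (hAt : 1 ≤ At)
    (m : Polynomial Fq) (hm : (X : Polynomial Fq) ^ (3 * At - 2) ∣ m) :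
    At * (Fintype.card Fq) ^ (14 * At) ≤
      Nat.card {v : (Polynomial Fq ⧸ Ideal.span {(X : Polynomial Fq) ^ (7 * At + 2)}) ×
          (Polynomial Fq ⧸ Ideal.span {(X : Polynomial Fq) ^ (7 * At + 2)}) ×
          (Polynomial Fq ⧸ Ideal.span {(X : Polynomial Fq) ^ (7 * At + 2)}) //
          v.1 ≠ 0 ∧ v.2.1 ≠ 0 ∧ v.2.2 ≠ 0 ∧
          v.1 ^ 3 + v.2.1 ^ 3 + v.2.2 ^ 3 =
            Ideal.Quotient.mk (Ideal.span {(X : Polynomial Fq) ^ (7 * At + 2)}) m ∧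
          vs (7 * At + 2) v.1 = vs (7 * At + 2) v.2.1 ∧ vs (7 * At + 2) v.2.1 ≤ At ∧
          vs (7 * At + 2) v.2.1 ≤ vs (7 * At + 2) v.2.2 ∧
          vs (7 * At + 2) v.2.2 ≤ vs (7 * At + 2) v.2.1 + 1} := by
  classical
  set q := Fintype.card Fq with hq
  set c := 7 * At + 2 with hc
  have h3 : (3 : Fq) ≠ 0 := by
    intro h
    have hd : ringChar Fq ∣ 3 := ringChar.dvd (by exact_mod_cast h)
    rcases (Nat.dvd_prime Nat.prime_three).1 hd with h1 | h1
    · exact CharP.ringChar_ne_one h1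
    · exact hchar h1
  have hY : ∀ (a : Fin At) (u : Fin (c - a - 1) → Fq) (w : Fin (c - a - 2) → Fq),
      ∃ Y : Fq[X], Y.coeff 0 = -1 ∧ (X : Fq[X]) ^ c ∣ (X ^ (a : ℕ) * Y) ^ 3 +
        (X ^ (a : ℕ) * (1 + X * polyOf _ u)) ^ 3 +
        (X ^ ((a : ℕ) + 1) * (1 + X * polyOf _ w)) ^ 3 - m := by
    intro a u w
    have ha := a.2
    obtain ⟨M, hM⟩ : (X : Fq[X]) ^ (3 * (a : ℕ) + 1) ∣ m :=
      (pow_dvd_pow _ (by omega)).trans hm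
    obtain ⟨Y, h1, k, hk⟩ := hensel_aux h3
      ((1 + X * polyOf _ u) ^ 3 + X * (X ^ 2 * (1 + X * polyOf _ w) ^ 3 - M))
      (by simp [coeff_zero_eq_eval_zero]) (c - 3 * a - 1)
    refine ⟨Y, h1, k, ?_⟩
    have e : (X : Fq[X]) ^ c = X ^ (3 * (a : ℕ)) * X ^ (c - 3 * a - 1 + 1) := by
      rw [← pow_add]; congr 1; omega
    rw [hM, e, mul_assoc, ← hk]
    ring
  choose Y hY0 hYd using hY
  let T := Σ a : Fin At, (Fin (c - a - 1) → Fq) × (Fin (c - a - 2) → Fq) × (Fin (2 * a) → Fq)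
  have hT : Nat.card T = At * q ^ (2 * c - 3) := by
    rw [Nat.card_eq_fintype_card, Fintype.card_sigma]
    rw [Finset.sum_congr rfl (g := fun _ => q ^ (2 * c - 3))]
    · simp
    · intro a _
      have ha := a.2
      simp only [Fintype.card_prod, Fintype.card_fun, Fintype.card_fin, ← hq]
      rw [← pow_add, ← pow_add]
      congr 1
      omega
  have hle : At * q ^ (14 * At) ≤ Nat.card T := by
    rw [hT]
    exact Nat.mul_le_mul_left _ (Nat.pow_le_pow_right Fintype.card_pos (by omega))
  refine hle.trans ?_
  have hfin : Finite (Fq[X] ⧸ Ideal.span {(X : Fq[X]) ^ c}) := by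
    have : Module.Finite Fq (Fq[X] ⧸ Ideal.span {(X : Fq[X]) ^ c}) :=
      (monic_X_pow c).finite_quotient
    exact Module.finite_of_finite Fq
  have cY : ∀ (a : Fin At) u w (t : Fin (2 * a) → Fq),
      (Y a u w + X ^ (c - 3 * a) * polyOf _ t).coeff 0 ≠ 0 := by
    intro a u w t
    have ha := a.2
    rw [coeff_add, hY0, mul_coeff_zero, coeff_X_pow, if_neg (by omega)]
    simp
  have cu : ∀ p : Fq[X], (1 + X * p).coeff 0 ≠ 0 := by intro p; simp
  let mk := Ideal.Quotient.mk (Ideal.span {(X : Fq[X]) ^ c})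
  refine Nat.card_le_card_of_injective (fun t : T =>
    ⟨(mk (X ^ (t.1 : ℕ) * (Y t.1 t.2.1 t.2.2.1 + X ^ (c - 3 * t.1) * polyOf _ t.2.2.2)),
      mk (X ^ (t.1 : ℕ) * (1 + X * polyOf _ t.2.1)),
      mk (X ^ ((t.1 : ℕ) + 1) * (1 + X * polyOf _ t.2.2.1))), ?_⟩) ?_
  · obtain ⟨a, u, w, t⟩ := t
    have ha := a.2
    dsimp only
    refine ⟨ne_zero_aux _ _ (by omega) _ (cY _ _ _ _), ne_zero_aux _ _ (by omega) _ (cu _),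
      ne_zero_aux _ _ (by omega) _ (cu _), ?_, ?_⟩
    · rw [← map_pow, ← map_pow, ← map_pow, ← map_add, ← map_add, Ideal.Quotient.eq,
        Ideal.mem_span_singleton]
      have hd := hYd a u w
      have e : (X : Fq[X]) ^ c = X ^ (3 * (a : ℕ)) * X ^ (c - 3 * a) := by
        rw [← pow_add]; congr 1; omega
      set y := Y a u w
      set z := polyOf _ t
      have e2 : (X ^ (a : ℕ) * (y + X ^ (c - 3 * a) * z)) ^ 3 =
          (X ^ (a : ℕ) * y) ^ 3 + X ^ c * (3 * y ^ 2 * z + 3 * y * z ^ 2 * X ^ (c - 3 * a)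
            + z ^ 3 * (X ^ (c - 3 * a)) ^ 2) := by
        rw [e]; ring
      rw [e2]
      convert dvd_add hd (dvd_mul_right (X ^ c) (3 * y ^ 2 * z + 3 * y * z ^ 2 * X ^ (c - 3 * a)
            + z ^ 3 * (X ^ (c - 3 * a)) ^ 2)) using 1
      ring
    · rw [vs_aux _ _ (by omega) _ (cY _ _ _ _), vs_aux _ _ (by omega) _ (cu _),
        vs_aux _ _ (by omega) _ (cu _)]
      omega
  · rintro ⟨a, u, w, t⟩ ⟨a', u', w', t'⟩ h
    have ha := a.2
    have ha' := a'.2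
    simp only [Subtype.mk.injEq, Prod.mk.injEq] at h
    obtain ⟨e1, e2, e3⟩ := h
    have haa : a = a' := by
      have := congrArg (vs c) e2
      rw [vs_aux _ _ (by omega) _ (cu _), vs_aux _ _ (by omega) _ (cu _)] at this
      exact Fin.ext this
    subst haa
    rw [Ideal.Quotient.eq, Ideal.mem_span_singleton] at e1 e2 e3
    have hu : u = u' := by
      apply polyOf_inj c (a + 1) _ (by omega)
      convert e2 using 1
      ring
    have hw : w = w' := by
      apply polyOf_inj c (a + 2) _ (by omega)
      convert e3 using 1
      ring
    subst hu hw
    have ht : t = t' := by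
      apply polyOf_inj c (a + (c - 3 * a)) _ (by omega)
      convert e1 using 1
      ring
    rw [ht]
end

section
/- Suppose char(F_q) ≠ 3. Let c ≥ 2 be an integer and let m ∈ F_q[s] be a polynomial divisible by s. Then the number of triples (x₁,x₂,x₃) ∈ (F_q[s]/(s^c))³ with x₁³ + x₂³ + x₃³ equal to the image of m, with x₁ and x₂ units (i.e. v_s(x₁) = v_s(x₂) = 0) and with x₃ nonzero of valuation v_s(x₃) = 1, is at least q^{2(c−2)}. -/
open Polynomial

lemma exists_cube_root_aux {R : Type*} [CommRing R] (h3 : IsUnit (3 : R)) (n : R)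
    (hn : IsNilpotent n) : ∃ x : R, x ^ 3 = -1 + n ∧ IsUnit x := by
  have key := Polynomial.existsUnique_nilpotent_sub_and_aeval_eq_zero (R := R) (S := R)
    (P := (X : Polynomial R) ^ 3 - C (-1 + n)) (x := (-1 : R)) (by
      have : (aeval (-1 : R)) ((X : Polynomial R) ^ 3 - C (-1 + n)) = -n := by
        simp; ring
      rw [this]; exact hn.neg) (by
      have : (aeval (-1 : R)) (derivative ((X : Polynomial R) ^ 3 - C (-1 + n))) = 3 := by
        simp; norm_num
      rw [this]; exact h3)
  obtain ⟨r, ⟨-, hr⟩, -⟩ := key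
  have hr' : r ^ 3 = -1 + n := by
    have : r ^ 3 - (-1 + n) = 0 := by simpa using hr
    exact sub_eq_zero.1 this
  refine ⟨r, hr', ?_⟩
  have : IsUnit (r ^ 3) := by
    rw [hr']
    have := (hn.neg.isUnit_one_add).neg
    convert this using 1
    ring
  exact (isUnit_pow_iff (by norm_num)).1 this

lemma three_isUnit_aux {F : Type*} [Field F] (hchar : ringChar F ≠ 3) : IsUnit (3 : F) := by
  rw [isUnit_iff_ne_zero]
  intro h
  have h1 : ringChar F ∣ 3 := (ringChar.spec F 3).1 (by exact_mod_cast h)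
  rcases (Nat.dvd_prime Nat.prime_three).1 h1 with h2 | h2
  · have : ((1 : ℕ) : F) = 0 := (ringChar.spec F 1).2 (by rw [h2])
    simp at this
  · exact hchar h2

lemma card_degreeLT_aux (F : Type*) [Field F] [Fintype F] (n : ℕ) :
    Nat.card (degreeLT F n) = Fintype.card F ^ n := by
  rw [Nat.card_congr (degreeLTEquiv F n).toEquiv]
  simp

lemma mk_inj_aux {F : Type*} [Field F] {c : ℕ} (hc : 2 ≤ c) (p r : degreeLT F (c - 2))
    (h : Ideal.Quotient.mk (Ideal.span {(X : Polynomial F) ^ c}) (X ^ 2 * p.1) =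
      Ideal.Quotient.mk (Ideal.span {(X : Polynomial F) ^ c}) (X ^ 2 * r.1)) : p = r := by
  rw [Ideal.Quotient.eq, Ideal.mem_span_singleton, ← mul_sub] at h
  obtain ⟨d, rfl⟩ := Nat.exists_eq_add_of_le hc
  rw [pow_add, mul_dvd_mul_iff_left (pow_ne_zero _ X_ne_zero)] at h
  have hd : ((p - r : degreeLT F (2 + d - 2)) : Polynomial F).degree < d := by
    have := mem_degreeLT.1 (p - r).2
    simpa using this
  have h0 : (p.1 - r.1 : Polynomial F) = 0 := by
    refine eq_zero_of_dvd_of_degree_lt h ?_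
    simpa using hd
  exact Subtype.ext (sub_eq_zero.1 h0)

lemma vs_aux_s11 {F : Type*} [Field F] {c : ℕ}
    (u x : Polynomial F ⧸ Ideal.span {(X : Polynomial F) ^ c}) (hu : IsUnit u)
    (hx : x = Ideal.Quotient.mk (Ideal.span {(X : Polynomial F) ^ c}) X * u)
    (h0 : Ideal.Quotient.mk (Ideal.span {(X : Polynomial F) ^ c}) X ≠ 0)
    (hnil : IsNilpotent (Ideal.Quotient.mk (Ideal.span {(X : Polynomial F) ^ c}) X)) :
    vs c x = 1 := by
  unfold vs
  set s := Ideal.Quotient.mk (Ideal.span {(X : Polynomial F) ^ c}) X with hs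
  apply IsGreatest.csSup_eq
  constructor
  · simp [hx]
  · intro n hn
    by_contra! hlt
    have h2 : s ^ 2 ∣ s * u := hx ▸ (pow_dvd_pow s hlt).trans hn
    rw [hu.dvd_mul_right] at h2
    obtain ⟨a, ha⟩ := h2
    have hz : s * (1 - s * a) = 0 := by
      linear_combination ha
    have hun : IsUnit (1 - s * a) := ((Commute.all s a).isNilpotent_mul_right hnil).isUnit_one_sub
    exact h0 ((hun.mul_left_eq_zero).1 hz)

/-- Suppose `char(F_q) ≠ 3`. Let `c ≥ 2` be an integer and `m ∈ F_q[s]` divisible by `s`.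
Then the number of triples `(x₁,x₂,x₃) ∈ (F_q[s]/(s^c))³` with `x₁³ + x₂³ + x₃³` equal to
the image of `m`, with `x₁, x₂` units and with `x₃` nonzero of valuation `v_s(x₃) = 1`,
is at least `q^{2(c−2)}`. -/
theorem count_unit_solutions_ge (Fq : Type*) [Field Fq] [Fintype Fq]
    (hchar : ringChar Fq ≠ 3) (c : ℕ) (hc : 2 ≤ c)
    (m : Polynomial Fq) (hm : (X : Polynomial Fq) ∣ m) :
    (Fintype.card Fq) ^ (2 * (c - 2)) ≤
      Nat.card {v : (Polynomial Fq ⧸ Ideal.span {(X : Polynomial Fq) ^ c}) ×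
          (Polynomial Fq ⧸ Ideal.span {(X : Polynomial Fq) ^ c}) ×
          (Polynomial Fq ⧸ Ideal.span {(X : Polynomial Fq) ^ c}) //
          v.1 ^ 3 + v.2.1 ^ 3 + v.2.2 ^ 3 =
            Ideal.Quotient.mk (Ideal.span {(X : Polynomial Fq) ^ c}) m ∧
          IsUnit v.1 ∧ IsUnit v.2.1 ∧ v.2.2 ≠ 0 ∧ vs c v.2.2 = 1} := by
  classical
  set I := Ideal.span {(X : Polynomial Fq) ^ c} with hI
  set s : Polynomial Fq ⧸ I := Ideal.Quotient.mk I X with hs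
  have hnil : IsNilpotent s := ⟨c, by
    rw [hs, ← map_pow, Ideal.Quotient.eq_zero_iff_mem]
    exact Ideal.mem_span_singleton_self _⟩
  have hs0 : s ≠ 0 := by
    rw [hs, Ne, Ideal.Quotient.eq_zero_iff_mem, Ideal.mem_span_singleton]
    intro h
    have := degree_le_of_dvd h X_ne_zero
    rw [degree_X_pow, degree_X] at this
    have : c ≤ 1 := by exact_mod_cast this
    omega
  have h3 : IsUnit (3 : Polynomial Fq ⧸ I) := by
    have := (three_isUnit_aux hchar).map ((Ideal.Quotient.mk I).comp C)
    rwa [map_ofNat] at this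
  have hfin : Finite (Polynomial Fq ⧸ I) := by
    have : Module.Finite Fq (Polynomial Fq ⧸ I) := (monic_X_pow c).finite_quotient
    exact Module.finite_of_finite Fq
  obtain ⟨m', rfl⟩ := hm
  have hmul : ∀ a, IsNilpotent (s * a) := fun a =>
    (Commute.all s a).isNilpotent_mul_right hnil
  have key : ∀ p r : Polynomial Fq, ∃ y : Polynomial Fq ⧸ I,
      (1 + Ideal.Quotient.mk I (X ^ 2 * p)) ^ 3 + y ^ 3 +
        (s + Ideal.Quotient.mk I (X ^ 2 * r)) ^ 3 = Ideal.Quotient.mk I (X * m') ∧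
      IsUnit y := by
    intro p r
    set p' := Ideal.Quotient.mk I p
    set r' := Ideal.Quotient.mk I r
    set m'' := Ideal.Quotient.mk I m'
    obtain ⟨y, hy, hyu⟩ := exists_cube_root_aux h3
      (s * (m'' - (3 * s * p' + 3 * s ^ 3 * p' ^ 2 + s ^ 5 * p' ^ 3)
        - s ^ 2 * (1 + s * r') ^ 3)) (hmul _)
    refine ⟨y, ?_, hyu⟩
    simp only [map_mul, map_pow]
    rw [hy]
    ring
  choose y hy hyu using key
  have hcard : Fintype.card Fq ^ (2 * (c - 2)) =
      Nat.card (degreeLT Fq (c - 2) × degreeLT Fq (c - 2)) := by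
    rw [Nat.card_prod, card_degreeLT_aux, ← pow_add, two_mul]
  rw [hcard]
  have hx3 : ∀ r : Polynomial Fq, s + Ideal.Quotient.mk I (X ^ 2 * r) =
      s * (1 + s * Ideal.Quotient.mk I r) := by
    intro r
    simp only [map_mul, map_pow]
    ring
  refine Nat.card_le_card_of_injective (fun v => ⟨(1 + Ideal.Quotient.mk I (X ^ 2 * v.1.1),
    y v.1.1 v.2.1, s + Ideal.Quotient.mk I (X ^ 2 * v.2.1)), hy _ _, ?_, hyu _ _, ?_, ?_⟩) ?_
  · have := (hmul (s * Ideal.Quotient.mk I v.1.1)).isUnit_one_add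
    convert this using 2
    simp only [map_mul, map_pow]
    ring
  · intro h
    simp only [hx3] at h
    exact hs0 (((hmul _).isUnit_one_add.mul_left_eq_zero).1 h)
  · exact vs_aux_s11 _ _ (hmul _).isUnit_one_add (hx3 _) hs0 hnil
  · rintro ⟨p, r⟩ ⟨p', r'⟩ h
    simp only [Subtype.mk.injEq, Prod.mk.injEq, add_right_inj] at h
    exact Prod.ext (mk_inj_aux hc _ _ h.1) (mk_inj_aux hc _ _ h.2.2)
end
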